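/- arXiv:1307.5923 — 2 statements merged into one kernel-verified Lean document; each statement's English description precedes it below -/
import Mathlib

section
/- For all integers n, m ≥ 0 and all integers k, l with 0 ≤ k ≤ n and 0 ≤ l ≤ m, the functions Q_n^k form an orthonormal family in L²(B₂): ∫_{B₂} Q_n^k(x,y)·Q_m^l(x,y) dx dy = 1 if (n,k) = (m,l), and = 0 otherwise. -/
open MeasureTheory Real Filter

/-- The Gegenbauer polynomials `C_n^λ`, defined by their triple recursion. -/
noncomputable def gegenbauer (lam : ℝ) : ℕ → ℝ → ℝ
  | 0, _ => 1
  | 1, t => 2 * lam * t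
  | (n + 2), t =>
      (2 * (((n : ℝ) + 1) + lam) / ((n : ℝ) + 2)) * t * gegenbauer lam (n + 1) t
        - ((((n : ℝ) + 1) + 2 * lam - 1) / ((n : ℝ) + 2)) * gegenbauer lam n t

/-- The open unit disk in `ℝ²`. -/
def unitDisk : Set (ℝ × ℝ) := {p | p.1 ^ 2 + p.2 ^ 2 < 1}

/-- The normalization constant `h_{k,n}`. -/
noncomputable def hConst (k n : ℕ) : ℝ :=
  Real.sqrt ((π / 4 ^ k) * (Nat.factorial (n + k + 1)) /
    (((n : ℝ) + 1) * (2 * (k : ℝ) + 1) * ((Nat.factorial k : ℝ)) ^ 2 *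
      (Nat.factorial (n - k) : ℝ)))

/-- The orthonormal polynomial basis `Q_n^k` on the unit disk. -/
noncomputable def Q2 (n k : ℕ) (x y : ℝ) : ℝ :=
  (1 / hConst k n) * gegenbauer ((k : ℝ) + 1) (n - k) x *
    (1 - x ^ 2) ^ ((k : ℝ) / 2) * gegenbauer (1 / 2) k (y / Real.sqrt (1 - x ^ 2))

namespace Gegenbauer

lemma succ_succ (lam : ℝ) (n : ℕ) (t : ℝ) :
    ((n : ℝ) + 2) * gegenbauer lam (n + 2) t =
      2 * ((n : ℝ) + 1 + lam) * t * gegenbauer lam (n + 1) t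
        - ((n : ℝ) + 2 * lam) * gegenbauer lam n t := by
  have h : (n : ℝ) + 2 ≠ 0 := by positivity
  rw [gegenbauer]
  field_simp
  ring

lemma contDiff (lam : ℝ) (n : ℕ) : ContDiff ℝ 1 (gegenbauer lam n) := by
  induction n using Nat.twoStepInduction with
  | zero => simpa only [funext fun t => gegenbauer.eq_1 lam t] using contDiff_const
  | one =>
    simp only [funext fun t => gegenbauer.eq_2 lam t]
    fun_prop
  | more n ih₁ ih₂ =>
    simp only [funext fun t => gegenbauer.eq_3 lam t n]
    fun_prop

@[fun_prop]
lemma continuous (lam : ℝ) (n : ℕ) : Continuous (gegenbauer lam n) :=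
  (contDiff lam n).continuous

lemma hasDerivAt (lam : ℝ) (n : ℕ) (t : ℝ) :
    HasDerivAt (gegenbauer lam n) (deriv (gegenbauer lam n) t) t :=
  ((contDiff lam n).differentiable (by norm_num) t).hasDerivAt

lemma deriv_zero (lam t : ℝ) : deriv (gegenbauer lam 0) t = 0 := by
  rw [funext fun t => gegenbauer.eq_1 lam t]
  simp

lemma deriv_one (lam t : ℝ) : deriv (gegenbauer lam 1) t = 2 * lam := by
  rw [funext fun t => gegenbauer.eq_2 lam t]
  simp

lemma deriv_succ_succ (lam : ℝ) (n : ℕ) (t : ℝ) :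
    ((n : ℝ) + 2) * deriv (gegenbauer lam (n + 2)) t =
      2 * ((n : ℝ) + 1 + lam) *
          (gegenbauer lam (n + 1) t + t * deriv (gegenbauer lam (n + 1)) t)
        - ((n : ℝ) + 2 * lam) * deriv (gegenbauer lam n) t := by
  have h₁ := (hasDerivAt lam (n + 2) t).const_mul ((n : ℝ) + 2)
  have h₂ := ((((hasDerivAt_id t).const_mul (2 * ((n : ℝ) + 1 + lam))).mul
    (hasDerivAt lam (n + 1) t))).sub ((hasDerivAt lam n t).const_mul ((n : ℝ) + 2 * lam))
  have h₃ := h₁.congr_of_eventuallyEq (Eventually.of_forall fun s => (succ_succ lam n s).symm)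
  rw [h₃.unique h₂]
  simp only [id]
  ring

/-- The ladder relations between consecutive derivatives. -/
lemma deriv_ladder (lam : ℝ) (n : ℕ) (t : ℝ) :
    deriv (gegenbauer lam (n + 1)) t =
        t * deriv (gegenbauer lam n) t + ((n : ℝ) + 2 * lam) * gegenbauer lam n t ∧
      ((n : ℝ) + 1) * gegenbauer lam (n + 1) t =
        t * deriv (gegenbauer lam (n + 1)) t - deriv (gegenbauer lam n) t := by
  induction n with
  | zero => simp [gegenbauer, mul_comm]
  | succ n ih =>
    obtain ⟨h₁, h₂⟩ := ih
    have h₃ := deriv_succ_succ lam n t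
    have h₄ := succ_succ lam n t
    have h : (n : ℝ) + 2 ≠ 0 := by positivity
    have h₅ : deriv (gegenbauer lam (n + 2)) t = t * deriv (gegenbauer lam (n + 1)) t
        + ((n : ℝ) + 1 + 2 * lam) * gegenbauer lam (n + 1) t := by
      apply mul_left_cancel₀ h
      linear_combination h₃ + (-(n : ℝ) - 2 * lam) * h₂
    push_cast
    refine ⟨h₅, ?_⟩
    rw [show n + 1 + 1 = n + 2 from rfl, h₅]
    linear_combination h₄ + t * h₂ + h₁

lemma one_sub_sq_mul_deriv_succ (lam : ℝ) (n : ℕ) (t : ℝ) :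
    (1 - t ^ 2) * deriv (gegenbauer lam (n + 1)) t =
      ((n : ℝ) + 2 * lam) * gegenbauer lam n t
        - ((n : ℝ) + 1) * (t * gegenbauer lam (n + 1) t) := by
  obtain ⟨h₁, h₂⟩ := deriv_ladder lam n t
  linear_combination h₁ + t * h₂

/-- The Gegenbauer differential equation. -/
lemma hasDerivAt_one_sub_sq_mul_deriv (lam : ℝ) (n : ℕ) (t : ℝ) :
    HasDerivAt (fun s => (1 - s ^ 2) * deriv (gegenbauer lam n) s)
      ((2 * lam - 1) * t * deriv (gegenbauer lam n) t
        - (n : ℝ) * ((n : ℝ) + 2 * lam) * gegenbauer lam n t) t := by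
  cases n with
  | zero => simpa [deriv_zero] using hasDerivAt_const t (0 : ℝ)
  | succ n =>
    have h := ((hasDerivAt lam n t).const_mul ((n : ℝ) + 2 * lam)).sub
      (((hasDerivAt_id t).mul (hasDerivAt lam (n + 1) t)).const_mul ((n : ℝ) + 1))
    have h' := h.congr_of_eventuallyEq
      (Eventually.of_forall fun s => one_sub_sq_mul_deriv_succ lam n s)
    refine h'.congr_deriv ?_
    obtain ⟨-, h₂⟩ := deriv_ladder lam n t
    simp only [id]
    push_cast
    linear_combination ((n : ℝ) + 2 * lam) * h₂

lemma hasDerivAt_weight (a : ℝ) {t : ℝ} (ht : t ∈ Set.Ioo (-1 : ℝ) 1) :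
    HasDerivAt (fun s : ℝ => (1 - s ^ 2) ^ a) (-(2 * a * t) * (1 - t ^ 2) ^ a / (1 - t ^ 2)) t := by
  have hp : 0 < 1 - t ^ 2 := by nlinarith [ht.1, ht.2]
  have h := (((hasDerivAt_id t).pow 2).const_sub 1).rpow_const (p := a) (Or.inl hp.ne')
  refine h.congr_deriv ?_
  simp only [id, Pi.pow_apply, rpow_sub_one hp.ne']
  push_cast
  ring

lemma continuous_weight {a : ℝ} (ha : 0 ≤ a) : Continuous fun s : ℝ => (1 - s ^ 2) ^ a :=
  (by fun_prop : Continuous fun s : ℝ => 1 - s ^ 2).rpow_const fun _ => Or.inr ha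

/-- Gegenbauer polynomials of different degrees are orthogonal. -/
lemma integral_mul_eq_zero {lam : ℝ} (hlam : 1 / 2 ≤ lam) {n m : ℕ} (hnm : n ≠ m) :
    ∫ t in (-1 : ℝ)..1, (1 - t ^ 2) ^ (lam - 1 / 2) *
      (gegenbauer lam n t * gegenbauer lam m t) = 0 := by
  have hw := continuous_weight (a := lam - 1 / 2) (by linarith)
  have hc (j : ℕ) : Continuous fun s : ℝ => (1 - s ^ 2) * deriv (gegenbauer lam j) s :=
    continuous_iff_continuousAt.2 fun t => (hasDerivAt_one_sub_sq_mul_deriv lam j t).continuousAt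
  have key := intervalIntegral.integral_eq_sub_of_hasDerivAt_of_le (a := (-1 : ℝ)) (b := 1)
    (f := fun s => (1 - s ^ 2) ^ (lam - 1 / 2) *
      ((1 - s ^ 2) * deriv (gegenbauer lam n) s * gegenbauer lam m s
        - (1 - s ^ 2) * deriv (gegenbauer lam m) s * gegenbauer lam n s))
    (f' := fun s => ((m : ℝ) * (m + 2 * lam) - n * (n + 2 * lam)) *
      ((1 - s ^ 2) ^ (lam - 1 / 2) * (gegenbauer lam n s * gegenbauer lam m s)))
    (by norm_num)
    (hw.mul (((hc n).mul (continuous lam m)).sub ((hc m).mul (continuous lam n)))).continuousOn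
    (fun t ht => by
      have hp : 1 - t ^ 2 ≠ 0 := by nlinarith [ht.1, ht.2]
      refine ((hasDerivAt_weight _ ht).mul
        (((hasDerivAt_one_sub_sq_mul_deriv lam n t).mul (hasDerivAt lam m t)).sub
        ((hasDerivAt_one_sub_sq_mul_deriv lam m t).mul (hasDerivAt lam n t)))).congr_deriv ?_
      simp only [Pi.mul_apply, Pi.sub_apply]
      field_simp
      ring)
    ((continuous_const.mul (hw.mul
      ((continuous lam n).mul (continuous lam m)))).intervalIntegrable _ _)
  rw [intervalIntegral.integral_const_mul] at key
  refine (mul_eq_zero.1 (key.trans (by norm_num))).resolve_left fun h => hnm ?_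
  have h' : ((m : ℝ) - n) * (m + n + 2 * lam) = 0 := by linear_combination h
  rcases mul_eq_zero.1 h' with h | h
  · exact_mod_cast (sub_eq_zero.1 h).symm
  · have : (0 : ℝ) < m + n + 2 * lam := by positivity
    exact absurd h this.ne'

/-- The recursion satisfied by the squared weighted `L²` norms. -/
lemma integral_sq_succ {lam : ℝ} (hlam : 1 / 2 ≤ lam) (n : ℕ) :
    ((n : ℝ) + 1) * (n + 1 + lam) * ∫ t in (-1 : ℝ)..1, (1 - t ^ 2) ^ (lam - 1 / 2) *
        (gegenbauer lam (n + 1) t * gegenbauer lam (n + 1) t) =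
      ((n : ℝ) + lam) * (n + 2 * lam) * ∫ t in (-1 : ℝ)..1, (1 - t ^ 2) ^ (lam - 1 / 2) *
        (gegenbauer lam n t * gegenbauer lam n t) := by
  have hw := continuous_weight (a := lam - 1 / 2) (by linarith)
  have hI (i j : ℕ) : IntervalIntegrable (fun t : ℝ => (1 - t ^ 2) ^ (lam - 1 / 2) *
      (gegenbauer lam i t * gegenbauer lam j t)) volume (-1) 1 :=
    (hw.mul ((continuous lam i).mul (continuous lam j))).intervalIntegrable _ _
  have hJ : IntervalIntegrable (fun t : ℝ => (1 - t ^ 2) ^ (lam - 1 / 2) *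
      (t * gegenbauer lam n t * gegenbauer lam (n + 1) t)) volume (-1) 1 :=
    (hw.mul ((continuous_id.mul (continuous lam n)).mul
      (continuous lam (n + 1)))).intervalIntegrable _ _
  have h₁ : ((n : ℝ) + 1) * ∫ t in (-1 : ℝ)..1, (1 - t ^ 2) ^ (lam - 1 / 2) *
        (gegenbauer lam (n + 1) t * gegenbauer lam (n + 1) t) =
      2 * ((n : ℝ) + lam) * ∫ t in (-1 : ℝ)..1, (1 - t ^ 2) ^ (lam - 1 / 2) *
        (t * gegenbauer lam n t * gegenbauer lam (n + 1) t) := by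
    rw [← intervalIntegral.integral_const_mul, ← intervalIntegral.integral_const_mul]
    cases n with
    | zero =>
      congr 1
      ext t
      simp [gegenbauer]
      ring
    | succ j =>
      have h₀ := integral_mul_eq_zero hlam (show j ≠ j + 2 by omega)
      rw [← add_zero (∫ _ in _.._, 2 * _ * _),
        ← mul_zero (-((j : ℝ) + 2 * lam)), ← h₀, ← intervalIntegral.integral_const_mul,
        ← intervalIntegral.integral_add (hJ.const_mul _) ((hI _ _).const_mul _)]
      congr 1
      ext t
      have := succ_succ lam j t
      push_cast
      linear_combination
        ((1 - t ^ 2) ^ (lam - 1 / 2) * gegenbauer lam (j + 2) t) * this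
  have h₂ : 2 * ((n : ℝ) + 1 + lam) * (∫ t in (-1 : ℝ)..1, (1 - t ^ 2) ^ (lam - 1 / 2) *
        (t * gegenbauer lam n t * gegenbauer lam (n + 1) t)) =
      ((n : ℝ) + 2 * lam) * ∫ t in (-1 : ℝ)..1, (1 - t ^ 2) ^ (lam - 1 / 2) *
        (gegenbauer lam n t * gegenbauer lam n t) := by
    have h₀ := integral_mul_eq_zero hlam (show n ≠ n + 2 by omega)
    rw [← add_zero (_ * ∫ _ in _.._, _ * (gegenbauer lam n _ * gegenbauer lam n _)),
      ← mul_zero ((n : ℝ) + 2), ← h₀,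
      ← intervalIntegral.integral_const_mul, ← intervalIntegral.integral_const_mul,
      ← intervalIntegral.integral_const_mul,
      ← intervalIntegral.integral_add ((hI _ _).const_mul _) ((hI _ _).const_mul _)]
    congr 1
    ext t
    have := succ_succ lam n t
    linear_combination
      (-(1 - t ^ 2) ^ (lam - 1 / 2) * gegenbauer lam n t) * this
  linear_combination ((n : ℝ) + 1 + lam) * h₁ + ((n : ℝ) + lam) * h₂

/-- The normalization of the Legendre polynomials. -/
lemma integral_half_sq (n : ℕ) :
    ∫ t in (-1 : ℝ)..1, gegenbauer (1 / 2) n t * gegenbauer (1 / 2) n t = 2 / (2 * n + 1) := by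
  induction n with
  | zero =>
    simp only [gegenbauer]
    norm_num
  | succ n ih =>
    have h := integral_sq_succ (le_refl (1 / 2 : ℝ)) n
    simp only [sub_self, rpow_zero, one_mul, ih] at h
    have h₁ : ((n : ℝ) + 1) * (n + 1 + 1 / 2) ≠ 0 := by positivity
    have h₂ : (2 * (n : ℝ) + 1) ≠ 0 := by positivity
    have h₃ : (2 * ((n : ℝ) + 1) + 1) ≠ 0 := by positivity
    apply mul_left_cancel₀ h₁
    rw [h]
    push_cast
    field_simp

lemma integral_weight_succ (k : ℕ) :
    (2 * (k : ℝ) + 4) * ∫ t in (-1 : ℝ)..1, (1 - t ^ 2) ^ ((k : ℝ) + 1 + 1 / 2) =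
      (2 * (k : ℝ) + 3) * ∫ t in (-1 : ℝ)..1, (1 - t ^ 2) ^ ((k : ℝ) + 1 / 2) := by
  have hw₀ := continuous_weight (a := (k : ℝ) + 1 / 2) (by positivity)
  have hw₁ := continuous_weight (a := (k : ℝ) + 1 + 1 / 2) (by positivity)
  have key := intervalIntegral.integral_eq_sub_of_hasDerivAt_of_le (a := (-1 : ℝ)) (b := 1)
    (f := fun s => s * (1 - s ^ 2) ^ ((k : ℝ) + 1 + 1 / 2))
    (f' := fun s => (2 * (k : ℝ) + 4) * (1 - s ^ 2) ^ ((k : ℝ) + 1 + 1 / 2)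
      - (2 * (k : ℝ) + 3) * (1 - s ^ 2) ^ ((k : ℝ) + 1 / 2))
    (by norm_num) (continuous_id.mul hw₁).continuousOn
    (fun t ht => by
      have hp : 0 < 1 - t ^ 2 := by nlinarith [ht.1, ht.2]
      refine ((hasDerivAt_id t).mul (hasDerivAt_weight _ ht)).congr_deriv ?_
      rw [show (k : ℝ) + 1 + 1 / 2 = (k + 1 / 2) + 1 by ring, rpow_add_one hp.ne']
      simp only [id]
      field_simp
      ring)
    (((continuous_const.mul hw₁).sub (continuous_const.mul hw₀)).intervalIntegrable _ _)
  rw [intervalIntegral.integral_sub ((hw₁.intervalIntegrable _ _).const_mul _)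
    ((hw₀.intervalIntegrable _ _).const_mul _),
    intervalIntegral.integral_const_mul, intervalIntegral.integral_const_mul] at key
  have h : ((k : ℝ) + 1 + 1 / 2) ≠ 0 := by positivity
  have : ((1 : ℝ) * (1 - 1 ^ 2) ^ ((k : ℝ) + 1 + 1 / 2)
      - (-1) * (1 - (-1) ^ 2) ^ ((k : ℝ) + 1 + 1 / 2)) = 0 := by
    norm_num [zero_rpow h]
  linarith

lemma integral_weight (k : ℕ) :
    ∫ t in (-1 : ℝ)..1, (1 - t ^ 2) ^ ((k : ℝ) + 1 / 2) =
      π * (2 * k + 1).factorial / (2 * 4 ^ k * k.factorial * (k + 1).factorial) := by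
  induction k with
  | zero =>
    simpa [sqrt_eq_rpow] using integral_sqrt_one_sub_sq
  | succ k ih =>
    have h := integral_weight_succ k
    have h₁ : (2 * (k : ℝ) + 4) ≠ 0 := by positivity
    have h₂ : (k.factorial : ℝ) ≠ 0 := by positivity
    have h₃ : (k : ℝ) + 1 ≠ 0 := by positivity
    have h₄ : (k : ℝ) + 1 + 1 ≠ 0 := by positivity
    rw [ih] at h
    apply mul_left_cancel₀ h₁
    push_cast
    rw [h, show 2 * (k + 1) + 1 = 2 * k + 1 + 1 + 1 by ring, Nat.factorial_succ (2 * k + 1 + 1),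
      Nat.factorial_succ (2 * k + 1), Nat.factorial_succ (k + 1), Nat.factorial_succ k]
    push_cast
    field_simp
    ring

/-- The squared norm of `C_N^{k+1}`. -/
lemma integral_nat_sq (k N : ℕ) :
    ∫ t in (-1 : ℝ)..1, (1 - t ^ 2) ^ ((k : ℝ) + 1 / 2) *
        (gegenbauer (k + 1) N t * gegenbauer (k + 1) N t) =
      π * (N + 2 * k + 1).factorial /
        (2 * 4 ^ k * ((N : ℝ) + k + 1) * k.factorial ^ 2 * N.factorial) := by
  induction N with
  | zero =>
    simp only [gegenbauer, mul_one, integral_weight, zero_add, Nat.factorial_succ k]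
    push_cast
    have h₂ : (k.factorial : ℝ) ≠ 0 := by positivity
    have h₃ : (k : ℝ) + 1 ≠ 0 := by positivity
    simp only [Nat.factorial_zero]
    push_cast
    field_simp
    ring
  | succ N ih =>
    have h := integral_sq_succ (lam := (k : ℝ) + 1) (by linarith [k.cast_nonneg (α := ℝ)]) N
    rw [show (k : ℝ) + 1 - 1 / 2 = k + 1 / 2 by ring, ih] at h
    have h₁ : ((N : ℝ) + 1) * (N + 1 + (k + 1)) ≠ 0 := by positivity
    have h₂ : (k.factorial : ℝ) ≠ 0 := by positivity
    have h₃ : (N.factorial : ℝ) ≠ 0 := by positivity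
    have h₄ : (N : ℝ) + k + 1 ≠ 0 := by positivity
    have h₅ : (N : ℝ) + 1 + k + 1 ≠ 0 := by positivity
    have h₆ : (N : ℝ) + 1 ≠ 0 := by positivity
    apply mul_left_cancel₀ h₁
    rw [h, show N + 1 + 2 * k + 1 = N + 2 * k + 1 + 1 by ring, Nat.factorial_succ (N + 2 * k + 1),
      Nat.factorial_succ N]
    push_cast
    field_simp
    ring

end Gegenbauer

lemma measurableSet_unitDisk : MeasurableSet unitDisk :=
  measurableSet_lt (by fun_prop) measurable_const

lemma unitDisk_subset : unitDisk ⊆ Set.Ioo (-1 : ℝ) 1 ×ˢ Set.Ioo (-1 : ℝ) 1 := by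
  rintro ⟨x, y⟩ h
  have h' : x ^ 2 + y ^ 2 < 1 := h
  exact ⟨abs_lt.1 ((sq_lt_one_iff_abs_lt_one x).1 (by nlinarith [sq_nonneg y])),
    abs_lt.1 ((sq_lt_one_iff_abs_lt_one y).1 (by nlinarith [sq_nonneg x]))⟩

lemma volume_unitDisk_lt_top : volume unitDisk < ⊤ := by
  refine (measure_mono unitDisk_subset).trans_lt ?_
  rw [Measure.volume_eq_prod, Measure.prod_prod, Real.volume_Ioo]
  exact ENNReal.mul_lt_top ENNReal.ofReal_lt_top ENNReal.ofReal_lt_top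

lemma mem_unitDisk_iff {x y : ℝ} :
    (x, y) ∈ unitDisk ↔ y ∈ Set.Ioo (-Real.sqrt (1 - x ^ 2)) (Real.sqrt (1 - x ^ 2)) := by
  rw [Set.mem_Ioo, ← abs_lt, Real.lt_sqrt (abs_nonneg y), sq_abs, lt_sub_iff_add_lt']
  rfl

lemma integrableOn_unitDisk {A f : ℝ → ℝ} (hA : Continuous A) (hf : Continuous f) :
    IntegrableOn (fun p : ℝ × ℝ => A p.1 * f (p.2 / Real.sqrt (1 - p.1 ^ 2))) unitDisk := by
  obtain ⟨a, ha⟩ := isCompact_Icc.exists_bound_of_continuousOn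
    (hA.continuousOn (s := Set.Icc (-1 : ℝ) 1))
  obtain ⟨b, hb⟩ := isCompact_Icc.exists_bound_of_continuousOn
    (hf.continuousOn (s := Set.Icc (-1 : ℝ) 1))
  have hm : Measurable fun p : ℝ × ℝ => A p.1 * f (p.2 / Real.sqrt (1 - p.1 ^ 2)) :=
    (hA.measurable.comp measurable_fst).mul (hf.measurable.comp (by fun_prop))
  refine Measure.integrableOn_of_bounded (M := a * b) volume_unitDisk_lt_top.ne
    hm.aestronglyMeasurable ((ae_restrict_iff' measurableSet_unitDisk).2 (ae_of_all _ ?_))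
  rintro ⟨x, y⟩ h
  have hx := Set.Ioo_subset_Icc_self (unitDisk_subset h).1
  have hy := abs_lt.2 (mem_unitDisk_iff.1 h)
  have ht : y / Real.sqrt (1 - x ^ 2) ∈ Set.Icc (-1 : ℝ) 1 := by
    rw [Set.mem_Icc, ← abs_le, abs_div, abs_of_nonneg (Real.sqrt_nonneg _)]
    exact div_le_one_of_le₀ hy.le (Real.sqrt_nonneg _)
  rw [norm_mul]
  exact mul_le_mul (ha x hx) (hb _ ht) (norm_nonneg _) ((norm_nonneg _).trans (ha x hx))

/-- Integration over the disk in the coordinates `x`, `t = y / √(1 - x²)`. -/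
lemma integral_unitDisk {A f : ℝ → ℝ} (hA : Continuous A) (hf : Continuous f) :
    ∫ p in unitDisk, A p.1 * f (p.2 / Real.sqrt (1 - p.1 ^ 2)) =
      (∫ x in (-1 : ℝ)..1, Real.sqrt (1 - x ^ 2) * A x) * ∫ t in (-1 : ℝ)..1, f t := by
  have hi := (integrable_indicator_iff measurableSet_unitDisk).2 (integrableOn_unitDisk hA hf)
  rw [← integral_indicator measurableSet_unitDisk, Measure.volume_eq_prod,
    integral_prod _ (by rwa [← Measure.volume_eq_prod]), ← intervalIntegral.integral_mul_const,
    intervalIntegral.integral_of_le (by norm_num), integral_Ioc_eq_integral_Ioo,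
    ← integral_indicator measurableSet_Ioo]
  congr 1
  ext x
  have hind : (fun y => unitDisk.indicator
      (fun p : ℝ × ℝ => A p.1 * f (p.2 / Real.sqrt (1 - p.1 ^ 2))) (x, y)) =
      (Set.Ioo (-Real.sqrt (1 - x ^ 2)) (Real.sqrt (1 - x ^ 2))).indicator
        fun y => A x * f (y / Real.sqrt (1 - x ^ 2)) := by
    ext y
    simp only [Set.indicator, mem_unitDisk_iff]
  rw [hind, integral_indicator measurableSet_Ioo, ← integral_Ioc_eq_integral_Ioo,
    ← intervalIntegral.integral_of_le (neg_le_self (Real.sqrt_nonneg _))]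
  by_cases hx : x ∈ Set.Ioo (-1 : ℝ) 1
  · have hs : Real.sqrt (1 - x ^ 2) ≠ 0 :=
      (Real.sqrt_pos.2 (by nlinarith [hx.1, hx.2])).ne'
    rw [Set.indicator_of_mem hx, intervalIntegral.integral_const_mul,
      intervalIntegral.integral_comp_div _ hs, neg_div, div_self hs, smul_eq_mul]
    ring
  · have hx' : 1 ≤ |x| := not_lt.1 fun h => hx (abs_lt.1 h)
    have hs : Real.sqrt (1 - x ^ 2) = 0 :=
      Real.sqrt_eq_zero_of_nonpos (by nlinarith [sq_abs x])
    rw [Set.indicator_of_notMem hx, hs]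
    simp

lemma hConst_sq (n k : ℕ) :
    hConst k n ^ 2 = (π / 4 ^ k) * (Nat.factorial (n + k + 1)) /
      (((n : ℝ) + 1) * (2 * (k : ℝ) + 1) * ((Nat.factorial k : ℝ)) ^ 2 *
        (Nat.factorial (n - k) : ℝ)) :=
  Real.sq_sqrt (by positivity)

lemma sqrt_mul_rpow_half_sq (k : ℕ) {x : ℝ} (hx : x ∈ Set.Icc (-1 : ℝ) 1) :
    Real.sqrt (1 - x ^ 2) * ((1 - x ^ 2) ^ ((k : ℝ) / 2) * (1 - x ^ 2) ^ ((k : ℝ) / 2)) =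
      (1 - x ^ 2) ^ ((k : ℝ) + 1 / 2) := by
  have hp : 0 ≤ 1 - x ^ 2 := by nlinarith [hx.1, hx.2]
  rw [Real.sqrt_eq_rpow, ← Real.rpow_add_of_nonneg hp (by positivity) (by positivity),
    ← Real.rpow_add_of_nonneg hp (by positivity) (by positivity)]
  congr 1
  ring

lemma integral_Q2_mul (n m k l : ℕ) :
    ∫ p in unitDisk, Q2 n k p.1 p.2 * Q2 m l p.1 p.2 =
      (∫ x in (-1 : ℝ)..1, Real.sqrt (1 - x ^ 2) *
        (1 / hConst k n * (1 / hConst l m) *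
          (((1 - x ^ 2) ^ ((k : ℝ) / 2) * (1 - x ^ 2) ^ ((l : ℝ) / 2)) *
            (gegenbauer (k + 1) (n - k) x * gegenbauer (l + 1) (m - l) x)))) *
      ∫ t in (-1 : ℝ)..1, gegenbauer (1 / 2) k t * gegenbauer (1 / 2) l t := by
  have hk := Gegenbauer.continuous_weight (a := (k : ℝ) / 2) (by positivity)
  have hl := Gegenbauer.continuous_weight (a := (l : ℝ) / 2) (by positivity)
  rw [← integral_unitDisk (by fun_prop) (by fun_prop)]
  congr 1
  ext p
  simp only [Q2]
  ring

/-- the `Q_n^k` form an orthonormal family in `L²(𝔹₂)`. -/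
theorem Q2_orthonormal (n m k l : ℕ) (hk : k ≤ n) (hl : l ≤ m) :
    (∫ p in unitDisk, Q2 n k p.1 p.2 * Q2 m l p.1 p.2) =
      if (n, k) = (m, l) then (1 : ℝ) else 0 := by
  rw [integral_Q2_mul]
  by_cases hkl : k = l
  swap
  · have h := Gegenbauer.integral_mul_eq_zero (le_refl (1 / 2 : ℝ)) hkl
    simp only [sub_self, rpow_zero, one_mul] at h
    rw [h, mul_zero, if_neg fun h => hkl (Prod.ext_iff.1 h).2]
  subst hkl
  have hx : ∫ x in (-1 : ℝ)..1, Real.sqrt (1 - x ^ 2) *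
        (1 / hConst k n * (1 / hConst k m) *
          (((1 - x ^ 2) ^ ((k : ℝ) / 2) * (1 - x ^ 2) ^ ((k : ℝ) / 2)) *
            (gegenbauer (k + 1) (n - k) x * gegenbauer (k + 1) (m - k) x))) =
      1 / hConst k n * (1 / hConst k m) * ∫ x in (-1 : ℝ)..1, (1 - x ^ 2) ^ ((k : ℝ) + 1 / 2) *
        (gegenbauer (k + 1) (n - k) x * gegenbauer (k + 1) (m - k) x) := by
    rw [← intervalIntegral.integral_const_mul]
    refine intervalIntegral.integral_congr fun x hx => ?_
    rw [Set.uIcc_of_le (by norm_num)] at hx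
    simp only [← sqrt_mul_rpow_half_sq k hx]
    ring
  rw [hx, Gegenbauer.integral_half_sq]
  by_cases hnm : n = m
  · subst hnm
    have hc : (((n - k : ℕ) : ℝ) + k + 1) = n + 1 := by
      push_cast [hk]
      ring
    rw [if_pos rfl, Gegenbauer.integral_nat_sq, hc,
      show n - k + 2 * k + 1 = n + k + 1 by omega,
      show 1 / hConst k n * (1 / hConst k n) = 1 / hConst k n ^ 2 by ring, hConst_sq]
    have h₁ : (k.factorial : ℝ) ≠ 0 := by positivity
    have h₂ : ((n - k).factorial : ℝ) ≠ 0 := by positivity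
    have h₃ : ((n + k + 1).factorial : ℝ) ≠ 0 := by positivity
    field_simp
  · have h := Gegenbauer.integral_mul_eq_zero (lam := (k : ℝ) + 1)
      (by linarith [k.cast_nonneg (α := ℝ)]) (show n - k ≠ m - k by omega)
    rw [show (k : ℝ) + 1 - 1 / 2 = k + 1 / 2 by ring] at h
    rw [h, mul_zero, zero_mul, if_neg fun h => hnm (Prod.ext_iff.1 h).1]
end

section
/- For every pair of integers 0 ≤ k ≤ n there exists a polynomial p ∈ ℝ[x,y] of total degree at most n such that Q_n^k(x,y) = p(x,y) for all (x,y) ∈ B₂. -/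
open MeasureTheory Real Filter

/-- The homogenization `w ^ (n / 2) * C_n^λ (t / √w)` of a Gegenbauer polynomial, in which `t` is
given weight one and `w` weight two. -/
noncomputable def homogenizedGegenbauer {σ : Type*} (lam : ℝ) (w t : MvPolynomial σ ℝ) :
    ℕ → MvPolynomial σ ℝ
  | 0 => 1
  | 1 => MvPolynomial.C (2 * lam) * t
  | (n + 2) =>
      MvPolynomial.C (2 * (((n : ℝ) + 1) + lam) / ((n : ℝ) + 2)) *
          (t * homogenizedGegenbauer lam w t (n + 1))
        - MvPolynomial.C ((((n : ℝ) + 1) + 2 * lam - 1) / ((n : ℝ) + 2)) *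
          (w * homogenizedGegenbauer lam w t n)

theorem totalDegree_C_mul_le {σ : Type*} (c : ℝ) (p : MvPolynomial σ ℝ) :
    (MvPolynomial.C c * p).totalDegree ≤ p.totalDegree :=
  (MvPolynomial.totalDegree_mul _ _).trans (by simp)

theorem totalDegree_homogenizedGegenbauer_le {σ : Type*} (lam : ℝ) {w t : MvPolynomial σ ℝ}
    (hw : w.totalDegree ≤ 2) (ht : t.totalDegree ≤ 1) (n : ℕ) :
    (homogenizedGegenbauer lam w t n).totalDegree ≤ n := by
  induction n using Nat.twoStepInduction with
  | zero => simp [homogenizedGegenbauer]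
  | one => exact (totalDegree_C_mul_le _ _).trans ht
  | more n ih₀ ih₁ =>
    rw [homogenizedGegenbauer]
    refine (MvPolynomial.totalDegree_sub _ _).trans (max_le ?_ ?_)
    · refine (totalDegree_C_mul_le _ _).trans ((MvPolynomial.totalDegree_mul _ _).trans ?_)
      omega
    · refine (totalDegree_C_mul_le _ _).trans ((MvPolynomial.totalDegree_mul _ _).trans ?_)
      omega

theorem eval_homogenizedGegenbauer {σ : Type*} (lam : ℝ) (w t : MvPolynomial σ ℝ) (v : σ → ℝ)
    {s : ℝ} (hs : s ≠ 0) (hsw : MvPolynomial.eval v w = s ^ 2) (n : ℕ) :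
    MvPolynomial.eval v (homogenizedGegenbauer lam w t n) =
      s ^ n * gegenbauer lam n (MvPolynomial.eval v t / s) := by
  induction n using Nat.twoStepInduction with
  | zero => simp [homogenizedGegenbauer, gegenbauer]
  | one =>
    simp only [homogenizedGegenbauer, gegenbauer, map_mul, MvPolynomial.eval_C]
    field_simp
  | more n ih₀ ih₁ =>
    simp only [homogenizedGegenbauer, gegenbauer, map_sub, map_mul, MvPolynomial.eval_C, ih₀, ih₁,
      hsw]
    have hn : (n : ℝ) + 2 ≠ 0 := by positivity
    field_simp
    ring

/-- each `Q_n^k` agrees on the unit disk with a polynomial of total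
degree at most `n`. -/
theorem Q2_is_polynomial (n k : ℕ) (hk : k ≤ n) :
    ∃ p : MvPolynomial (Fin 2) ℝ, p.totalDegree ≤ n ∧
      ∀ x y : ℝ, (x, y) ∈ unitDisk → MvPolynomial.eval ![x, y] p = Q2 n k x y := by
  open MvPolynomial in
  have hw : (1 - X 0 ^ 2 : MvPolynomial (Fin 2) ℝ).totalDegree ≤ 2 :=
    (totalDegree_sub _ _).trans (by simp)
  refine ⟨MvPolynomial.C (1 / hConst k n) *
    (homogenizedGegenbauer ((k : ℝ) + 1) 1 (MvPolynomial.X 0) (n - k) *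
      homogenizedGegenbauer (1 / 2) (1 - MvPolynomial.X 0 ^ 2) (MvPolynomial.X 1) k), ?_, ?_⟩
  · refine (totalDegree_C_mul_le _ _).trans ((MvPolynomial.totalDegree_mul _ _).trans ?_)
    have h₁ := totalDegree_homogenizedGegenbauer_le ((k : ℝ) + 1)
      (w := (1 : MvPolynomial (Fin 2) ℝ)) (t := MvPolynomial.X 0) (by simp) (by simp) (n - k)
    have h₂ := totalDegree_homogenizedGegenbauer_le (1 / 2) hw
      (t := MvPolynomial.X 1) (by simp) k
    omega
  · intro x y hxy
    have hxy' : x ^ 2 + y ^ 2 < 1 := hxy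
    have hpos : 0 < 1 - x ^ 2 := by nlinarith [sq_nonneg y]
    rw [Q2, Real.rpow_div_two_eq_sqrt _ hpos.le, Real.rpow_natCast, map_mul, map_mul,
      eval_homogenizedGegenbauer _ _ _ _ one_ne_zero (by simp),
      eval_homogenizedGegenbauer _ _ _ _ (Real.sqrt_pos.2 hpos).ne'
        (by simp [Real.sq_sqrt hpos.le])]
    simp only [MvPolynomial.eval_C, MvPolynomial.eval_X, one_pow, one_mul, div_one,
      Matrix.cons_val_zero, Matrix.cons_val_one]
    ring
end
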